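/- Let G be a planar loopless cubic graph with a fixed ordering of E(G), and let π and π′ be star labellings of G whose exponents are the constant function 2, such that both 2-factors D_π = E(G) − M_π and D_π′ = E(G) − M_π′ are bipartite (every cycle in them has even length). Then sgn(π) = sgn(π′). (Equivalently, normalizing the sign of one such labelling to be 1, every star labelling of G with exponent constantly 2 whose complementary 2-factor is bipartite has sign 1.) -/

import Mathlib

namespace FLL

variable {V E : Type}

/-- The flags of a multigraph: incident (vertex, edge) pairs. -/
def Flag (ends : E → Sym2 V) : Type := {p : V × E // p.1 ∈ ends p.2}

instance (ends : E → Sym2 V) [Fintype V] [Fintype E] [DecidableEq V] :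
    Fintype (Flag ends) := Subtype.fintype _

instance (ends : E → Sym2 V) [DecidableEq V] [DecidableEq E] :
    DecidableEq (Flag ends) := Subtype.instDecidableEq

/-- Degree of a vertex in a loopless multigraph: number of incident edges. -/
def deg [Fintype E] [DecidableEq V] (ends : E → Sym2 V) (v : V) : ℕ :=
  (Finset.univ.filter fun e => v ∈ ends e).card

/-- A multigraph is loopless if no edge joins a vertex to itself. -/
def Loopless (ends : E → Sym2 V) : Prop := ∀ e, ¬ (ends e).IsDiag

/-- A proper edge colouring: edges sharing an endpoint receive distinct colours. -/
def ProperEdgeColoring (ends : E → Sym2 V) (c : E → ℕ) : Prop :=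
  ∀ e e', e ≠ e' → (∃ v, v ∈ ends e ∧ v ∈ ends e') → c e ≠ c e'

/-- `G` is `f`-edge choosable. -/
def EdgeChoosable (ends : E → Sym2 V) (f : E → ℕ) : Prop :=
  ∀ L : E → Finset ℕ, (∀ e, f e ≤ (L e).card) →
    ∃ c : E → ℕ, ProperEdgeColoring ends c ∧ ∀ e, c e ∈ L e

/-- Reachability avoiding a set `X` of edges. -/
def ReachAvoiding (ends : E → Sym2 V) (X : Set E) : V → V → Prop :=
  Relation.ReflTransGen (fun u v => ∃ e, e ∉ X ∧ ends e = s(u, v))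

/-- A cut-edge: its removal disconnects its two endpoints. -/
def IsCutEdge (ends : E → Sym2 V) (e : E) : Prop :=
  ∀ u v : V, ends e = s(u, v) → ¬ ReachAvoiding ends {e} u v

/-- Connectivity of the multigraph. -/
def ConnectedG (ends : E → Sym2 V) : Prop :=
  ∀ u v : V, ReachAvoiding ends ∅ u v

/-- A planar embedding of a loopless multigraph: vertices are points of the plane,
edges are arcs between the endpoints, internally disjoint from each other
and from the vertices. -/
structure PlanarEmbedding (ends : E → Sym2 V) where
  vpos : V → ℝ × ℝ
  vinj : Function.Injective vpos
  arc : E → ℝ → ℝ × ℝ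
  arc_cont : ∀ e, ContinuousOn (arc e) (Set.Icc 0 1)
  arc_inj : ∀ e, Set.InjOn (arc e) (Set.Icc 0 1)
  arc_ends : ∀ e, Sym2.map vpos (ends e) = s(arc e 0, arc e 1)
  arc_avoid : ∀ e, ∀ t ∈ Set.Ioo (0:ℝ) 1, ∀ v, arc e t ≠ vpos v
  arc_disjoint : ∀ e e', e ≠ e' → ∀ t ∈ Set.Ioo (0:ℝ) 1, ∀ t' ∈ Set.Ioo (0:ℝ) 1,
    arc e t ≠ arc e' t'


variable [Fintype V] [DecidableEq V] [Fintype E] [DecidableEq E]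

/-- A star labelling of `G`: at each vertex `v`, the labels of the flags at `v`
form a bijection onto `{0, 1, …, deg v - 1}`. -/
def IsStarLabelling (ends : E → Sym2 V) (π : Flag ends → ℕ) : Prop :=
  ∀ v : V, (Finset.univ.filter (fun fl : Flag ends => fl.1.1 = v)).image π
      = Finset.range (deg ends v)

/-- The exponent of a star labelling: `w_π(e) = π_u(e) + π_v(e)` for `e = uv`. -/
def exponent (ends : E → Sym2 V) (π : Flag ends → ℕ) : E → ℕ :=
  fun e => ∑ fl ∈ Finset.univ.filter (fun fl : Flag ends => fl.1.2 = e), π fl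

/-- `M_π`: the set of edges both of whose flags receive label `1` under `π`. -/
def Mpi (ends : E → Sym2 V) (π : Flag ends → ℕ) : Set E :=
  {e | ∀ fl : Flag ends, fl.1.2 = e → π fl = 1}

/-- The sign of a star labelling, relative to a fixed linear ordering of the edges:
`sgn π = ∏_v sgn(π_v)`, where `sgn(π_v)` is the sign of the permutation of `{0,…,d-1}`
given by the labels at `v` read in increasing edge order; equivalently (as formalized
here) the product, over all pairs of flags at a common vertex taken in increasing edge
order, of the sign of the difference of their labels. -/
def starSign [LinearOrder E] (ends : E → Sym2 V) (π : Flag ends → ℕ) : ℤ :=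
  ∏ p ∈ Finset.univ.filter
      (fun p : Flag ends × Flag ends => p.1.1.1 = p.2.1.1 ∧ p.1.1.2 < p.2.1.2),
    Int.sign ((π p.2 : ℤ) - (π p.1 : ℤ))

end FLL


namespace FLL

open Complex in
/-- `Wind h n`: along `[0,1]`, a continuous logarithm of `h` changes by the difference of principal
logarithms plus `2πi n`. -/
def Wind (h : ℝ → ℂ) (n : ℤ) : Prop :=
  ∃ L : ℝ → ℂ, Continuous L ∧ (∀ s, Complex.exp (L s) = h s) ∧
    L 1 - L 0 = Complex.log (h 1) - Complex.log (h 0) + n * (2 * Real.pi * Complex.I)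

theorem wind_of_lift {h L : ℝ → ℂ} (hL : Continuous L) (hh : ∀ s, Complex.exp (L s) = h s) :
    ∃ n, Wind h n := by
  have h0 : ∀ s, h s ≠ 0 := fun s => by rw [← hh]; exact Complex.exp_ne_zero _
  have : Complex.exp (L 1 - L 0) = Complex.exp (Complex.log (h 1) - Complex.log (h 0)) := by
    rw [Complex.exp_sub, Complex.exp_sub, hh, hh, Complex.exp_log (h0 _), Complex.exp_log (h0 _)]
  obtain ⟨n, hn⟩ := Complex.exp_eq_exp_iff_exists_int.1 this
  exact ⟨n, L, hL, hh, hn⟩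

theorem wind_unique {h : ℝ → ℂ} {n m : ℤ} (hn : Wind h n) (hm : Wind h m) : n = m := by
  obtain ⟨L, hL, hh, hn⟩ := hn
  obtain ⟨L', hL', hh', hm⟩ := hm
  have hpi : (2 * Real.pi * Complex.I : ℂ) ≠ 0 := Complex.two_pi_I_ne_zero
  have key : ∀ s, ∃ k : ℤ, L s = L' s + k * (2 * Real.pi * Complex.I) := fun s =>
    Complex.exp_eq_exp_iff_exists_int.1 (by rw [hh, hh'])
  choose k hk using key
  have hkc : Continuous k := by
    have : Continuous (fun s => ((k s : ℤ) : ℝ)) := by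
      have e : (fun s => ((k s : ℤ) : ℝ)) =
          fun s => ((L s - L' s) / (2 * Real.pi * Complex.I)).re := by
        ext s
        rw [hk s, add_sub_cancel_left, mul_div_cancel_right₀ _ hpi]
        simp
      rw [e]
      exact Complex.continuous_re.comp ((hL.sub hL').div_const _)
    exact Int.isClosedEmbedding_coe_real.isInducing.continuous_iff.2 this
  have hc : k 1 = k 0 := (PreconnectedSpace.constant inferInstance hkc)
  have : (n : ℂ) * (2 * Real.pi * Complex.I) = m * (2 * Real.pi * Complex.I) := by
    have h1 := hk 1
    have h0 := hk 0
    rw [hc] at h1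
    linear_combination hm - hn + h1 - h0
  exact_mod_cast mul_right_cancel₀ hpi this

/-- The half-plane indicator. -/
noncomputable def gg (z : ℂ) : ℤ := if 0 < z.arg then 1 else 0

theorem log_neg_gg {z : ℂ} (hz : z ≠ 0) :
    Complex.log z - Complex.log (-z) = (2 * gg z - 1) * (Real.pi * Complex.I) := by
  have : z.arg - (-z).arg = (2 * gg z - 1) * Real.pi := by
    unfold gg
    split_ifs with h
    · rw [Complex.arg_neg_eq_arg_sub_pi_iff.2]
      · push_cast; ring
      · by_contra hcon
        push Not at hcon
        obtain ⟨h1, h2⟩ := hcon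
        rcases lt_or_eq_of_le h1 with h3 | h3
        · exact absurd h (not_lt.2 (Complex.arg_neg_iff.2 h3).le)
        · exact absurd h (not_lt.2 (by
            rcases lt_trichotomy z.re 0 with h4 | h4 | h4
            · exact absurd h4 (not_lt.2 (by simpa using h2 h3))
            · exact absurd (Complex.ext h4 h3) hz
            · rw [Complex.arg_eq_zero_iff.2 ⟨h4.le, h3⟩]))
    · rw [Complex.arg_neg_eq_arg_add_pi_iff.2]
      · push_cast; ring
      · by_contra hcon
        push Not at hcon
        obtain ⟨h1, h2⟩ := hcon
        apply h
        rcases lt_or_eq_of_le h1 with h3 | h3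
        · exact lt_of_le_of_ne (Complex.arg_nonneg_iff.2 h3.le) (fun h5 => by
            have := Complex.arg_eq_zero_iff.1 h5.symm
            linarith [this.2])
        · rcases lt_trichotomy z.re 0 with h4 | h4 | h4
          · rw [Complex.arg_eq_pi_iff.2 ⟨h4, h3.symm⟩]; exact Real.pi_pos
          · exact absurd (Complex.ext h4 h3.symm) hz
          · exact absurd h4 (not_lt.2 (h2 h3.symm))
  have h2 : Complex.log z - Complex.log (-z) = ((z.arg - (-z).arg : ℝ) : ℂ) * Complex.I := by
    simp only [Complex.log, norm_neg]
    push_cast; ring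
  rw [h2, this]; push_cast; ring

theorem gg_add {z : ℂ} (hz : z ≠ 0) : gg z + gg (-z) = 1 := by
  have h1 := log_neg_gg hz
  have h2 := log_neg_gg (neg_ne_zero.2 hz)
  rw [neg_neg] at h2
  have hpi : (2 * Real.pi * Complex.I : ℂ) ≠ 0 := Complex.two_pi_I_ne_zero
  have : ((gg z + gg (-z) : ℤ) : ℂ) * (2 * Real.pi * Complex.I) = (1 : ℤ) * (2 * Real.pi * Complex.I) := by
    push_cast
    linear_combination -h1 - h2
  exact_mod_cast mul_right_cancel₀ hpi this

theorem square {γ δ : ℝ → ℂ} (hγ : Continuous γ) (hδ : Continuous δ) (hd : ∀ s t, γ s ≠ δ t) :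
    ∃ n0 n1 m0 m1 : ℤ, Wind (fun s => γ s - δ 0) n0 ∧ Wind (fun s => γ s - δ 1) n1 ∧
      Wind (fun s => δ s - γ 0) m0 ∧ Wind (fun s => δ s - γ 1) m1 ∧
      n1 - n0 - m1 + m0 = - gg (γ 1 - δ 1) + gg (γ 0 - δ 1) + gg (γ 1 - δ 0) - gg (γ 0 - δ 0) := by
  let f : C(ℝ × ℝ, ℂ) := ⟨fun p => γ p.1 - δ p.2, by fun_prop⟩
  have hf : ∀ p, f p ≠ 0 := fun p => sub_ne_zero.2 (hd _ _)
  obtain ⟨F, ⟨-, hF⟩, -⟩ := Complex.isCoveringMapOn_exp.existsUnique_continuousMap_lifts f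
    (a₀ := (0, 0)) (e₀ := Complex.log (f (0, 0))) (Complex.exp_log (hf _)) hf
  have hF' : ∀ s t, Complex.exp (F (s, t)) = γ s - δ t := fun s t => congrFun hF (s, t)
  have hG' : ∀ s t, Complex.exp (F (s, t) + Real.pi * Complex.I) = δ t - γ s := fun s t => by
    rw [Complex.exp_add, Complex.exp_pi_mul_I, hF']; ring
  have w1 : ∀ t, ∃ n, Wind (fun s => γ s - δ t) n ∧ F (1, t) - F (0, t) =
      Complex.log (γ 1 - δ t) - Complex.log (γ 0 - δ t) + n * (2 * Real.pi * Complex.I) := by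
    intro t
    have : Complex.exp (F (1, t) - F (0, t)) =
      Complex.exp (Complex.log (γ 1 - δ t) - Complex.log (γ 0 - δ t)) := by
      rw [Complex.exp_sub, Complex.exp_sub, hF', hF', Complex.exp_log (sub_ne_zero.2 (hd _ _)),
        Complex.exp_log (sub_ne_zero.2 (hd _ _))]
    obtain ⟨n, hn⟩ := Complex.exp_eq_exp_iff_exists_int.1 this
    exact ⟨n, ⟨fun s => F (s, t), by fun_prop, fun s => hF' s t, hn⟩, hn⟩
  have w2 : ∀ s, ∃ n, Wind (fun t => δ t - γ s) n ∧ F (s, 1) - F (s, 0) =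
      Complex.log (δ 1 - γ s) - Complex.log (δ 0 - γ s) + n * (2 * Real.pi * Complex.I) := by
    intro s
    have : Complex.exp (F (s, 1) - F (s, 0)) =
      Complex.exp (Complex.log (δ 1 - γ s) - Complex.log (δ 0 - γ s)) := by
      rw [Complex.exp_sub, Complex.exp_sub, hF', hF', Complex.exp_log (sub_ne_zero.2 (hd _ _).symm),
        Complex.exp_log (sub_ne_zero.2 (hd _ _).symm), ← neg_sub (δ 1), ← neg_sub (δ 0), neg_div_neg_eq]
    obtain ⟨n, hn⟩ := Complex.exp_eq_exp_iff_exists_int.1 this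
    exact ⟨n, ⟨fun t => F (s, t) + Real.pi * Complex.I, by fun_prop, fun t => hG' s t, by
      rw [← hn]; ring⟩, hn⟩
  obtain ⟨n0, hn0, en0⟩ := w1 0
  obtain ⟨n1, hn1, en1⟩ := w1 1
  obtain ⟨m0, hm0, em0⟩ := w2 0
  obtain ⟨m1, hm1, em1⟩ := w2 1
  refine ⟨n0, n1, m0, m1, hn0, hn1, hm0, hm1, ?_⟩
  have g : ∀ s t, Complex.log (γ s - δ t) - Complex.log (δ t - γ s) =
      (2 * gg (γ s - δ t) - 1) * (Real.pi * Complex.I) := fun s t => by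
    have := log_neg_gg (sub_ne_zero.2 (hd s t))
    rwa [neg_sub] at this
  have hpi : (2 * Real.pi * Complex.I : ℂ) ≠ 0 := Complex.two_pi_I_ne_zero
  have : ((n1 - n0 - m1 + m0 : ℤ) : ℂ) * (2 * Real.pi * Complex.I) =
    ((- gg (γ 1 - δ 1) + gg (γ 0 - δ 1) + gg (γ 1 - δ 0) - gg (γ 0 - δ 0) : ℤ) : ℂ)
      * (2 * Real.pi * Complex.I) := by
    push_cast
    linear_combination -en1 + en0 + em1 - em0 - g 1 1 + g 0 1 + g 1 0 - g 0 0
  exact_mod_cast mul_right_cancel₀ hpi this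

open Classical in
theorem topo {V E : Type} {ends : E → Sym2 V} (P : PlanarEmbedding ends) :
    ∃ (B : E → V → ZMod 2) (g : V → V → ZMod 2), (∀ v, g v v = 0) ∧
      (∀ u v, u ≠ v → g u v + g v u = 1) ∧
      ∀ e f u v w z, ends e = s(u, v) → ends f = s(w, z) → u ≠ w → u ≠ z → v ≠ w → v ≠ z →
        B e w + B e z + B f u + B f v + g u w + g u z + g v w + g v z = 0 := by
  let pos : V → ℂ := fun v => Complex.equivRealProd.symm (P.vpos v)
  have posinj : Function.Injective pos := Complex.equivRealProd.symm.injective.comp P.vinj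
  let γ : E → ℝ → ℂ := fun e s =>
    Complex.equivRealProd.symm (P.arc e (Set.projIcc (0:ℝ) 1 zero_le_one s))
  have γc : ∀ e, Continuous (γ e) := fun e => by
    have h1 : Continuous (fun s : ℝ => P.arc e (Set.projIcc (0:ℝ) 1 zero_le_one s)) :=
      (continuousOn_iff_continuous_domRestrict.1 (P.arc_cont e)).comp continuous_projIcc
    exact Complex.equivRealProdCLM.symm.continuous.comp h1
  let B : E → V → ZMod 2 := fun e r =>
    if h : ∃ n, Wind (fun s => γ e s - pos r) n then ((h.choose : ℤ) : ZMod 2) else 0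
  have hB : ∀ e r n, Wind (fun s => γ e s - pos r) n → B e r = n := by
    intro e r n hn
    have h : ∃ n, Wind (fun s => γ e s - pos r) n := ⟨n, hn⟩
    have : h.choose = n := wind_unique h.choose_spec hn
    simp only [B, dif_pos h, this]
  let g : V → V → ZMod 2 := fun u v => (gg (pos u - pos v) : ZMod 2)
  refine ⟨B, g, ?_, ?_, ?_⟩
  · intro v; simp [g, gg]
  · intro u v huv
    have := gg_add (sub_ne_zero.2 (posinj.ne huv))
    rw [neg_sub] at this
    simp only [g]
    exact_mod_cast congrArg (Int.cast : ℤ → ZMod 2) this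
  -- main
  have hz2 : ∀ x : ZMod 2, x + x = 0 := by decide
  have main : ∀ e f u v w z, ends e = s(u, v) → ends f = s(w, z) → u ≠ w → u ≠ z → v ≠ w → v ≠ z →
      γ e 0 = pos u → γ e 1 = pos v → γ f 0 = pos w → γ f 1 = pos z →
        B e w + B e z + B f u + B f v + g u w + g u z + g v w + g v z = 0 := by
    intro e f u v w z he hf h1 h2 h3 h4 e0 e1 f0 f1
    have hef : e ≠ f := by
      rintro rfl
      rw [he] at hf
      simp [h1, h2] at hf
    have hd : ∀ s t, γ e s ≠ γ f t := by
      intro s t hst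
      have hst' : P.arc e (Set.projIcc (0:ℝ) 1 zero_le_one s) =
        P.arc f (Set.projIcc (0:ℝ) 1 zero_le_one t) := Complex.equivRealProd.symm.injective hst
      have q0 : ∀ e u, γ e 0 = pos u → P.arc e 0 = P.vpos u := fun e u h => by
        have := Complex.equivRealProd.symm.injective h
        simpa using this
      have q1 : ∀ e u, γ e 1 = pos u → P.arc e 1 = P.vpos u := fun e u h => by
        have := Complex.equivRealProd.symm.injective h
        simpa using this
      have e0' := q0 _ _ e0
      have e1' := q1 _ _ e1
      have f0' := q0 _ _ f0
      have f1' := q1 _ _ f1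
      generalize Set.projIcc (0:ℝ) 1 zero_le_one s = s at hst'
      generalize Set.projIcc (0:ℝ) 1 zero_le_one t = t at hst'
      obtain ⟨s, hs0, hs1⟩ := s
      obtain ⟨t, ht0, ht1⟩ := t
      simp only at hst'
      have cs : s = 0 ∨ s = 1 ∨ s ∈ Set.Ioo (0:ℝ) 1 := by
        rcases eq_or_lt_of_le hs0 with h | h
        · exact Or.inl h.symm
        · rcases eq_or_lt_of_le hs1 with h' | h'
          · exact Or.inr (Or.inl h')
          · exact Or.inr (Or.inr ⟨h, h'⟩)
      have ct : t = 0 ∨ t = 1 ∨ t ∈ Set.Ioo (0:ℝ) 1 := by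
        rcases eq_or_lt_of_le ht0 with h | h
        · exact Or.inl h.symm
        · rcases eq_or_lt_of_le ht1 with h' | h'
          · exact Or.inr (Or.inl h')
          · exact Or.inr (Or.inr ⟨h, h'⟩)
      rcases cs with rfl | rfl | hs <;> rcases ct with rfl | rfl | ht
      · rw [e0', f0'] at hst'; exact h1 (P.vinj hst')
      · rw [e0', f1'] at hst'; exact h2 (P.vinj hst')
      · rw [e0'] at hst'; exact P.arc_avoid f t ht _ hst'.symm
      · rw [e1', f0'] at hst'; exact h3 (P.vinj hst')
      · rw [e1', f1'] at hst'; exact h4 (P.vinj hst')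
      · rw [e1'] at hst'; exact P.arc_avoid f t ht _ hst'.symm
      · rw [f0'] at hst'; exact P.arc_avoid e s hs _ hst'
      · rw [f1'] at hst'; exact P.arc_avoid e s hs _ hst'
      · exact P.arc_disjoint e f hef s hs t ht hst'
    obtain ⟨n0, n1, m0, m1, a, b, c, d, hsum⟩ := square (γc e) (γc f) hd
    rw [f0] at a
    rw [f1] at b
    rw [e0] at c
    rw [e1] at d
    rw [hB _ _ _ a, hB _ _ _ b, hB _ _ _ c, hB _ _ _ d]
    rw [e0, e1, f0, f1] at hsum
    have hs := congrArg (Int.cast : ℤ → ZMod 2) hsum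
    push_cast at hs
    change _ = - g v z + g u z + g v w - g u w at hs
    generalize g v z = x1 at *
    generalize g u z = x2 at *
    generalize g v w = x3 at *
    generalize g u w = x4 at *
    linear_combination hs + hz2 n0 + hz2 m1 + hz2 x2 + hz2 x3
  have ori : ∀ e, ∃ u v, ends e = s(u, v) ∧ γ e 0 = pos u ∧ γ e 1 = pos v := by
    intro e
    obtain ⟨⟨u, v⟩, huv⟩ := Quot.exists_rep (ends e)
    have huv' : ends e = s(u, v) := huv.symm
    have h := P.arc_ends e
    rw [huv', Sym2.map_mk, Sym2.eq_iff] at h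
    rcases h with ⟨h1, h2⟩ | ⟨h1, h2⟩
    · exact ⟨u, v, huv', by simp [γ, pos, h1], by simp [γ, pos, h2]⟩
    · exact ⟨v, u, by rw [huv', Sym2.eq_swap], by simp [γ, pos, h2], by simp [γ, pos, h1]⟩
  intro e f u v w z he hf h1 h2 h3 h4
  obtain ⟨u', v', he', a, b⟩ := ori e
  obtain ⟨w', z', hf', c, d⟩ := ori f
  rw [he', Sym2.eq_iff] at he
  rw [hf', Sym2.eq_iff] at hf
  rcases he with ⟨rfl, rfl⟩ | ⟨rfl, rfl⟩ <;> rcases hf with ⟨rfl, rfl⟩ | ⟨rfl, rfl⟩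
  · exact main e f _ _ _ _ he' hf' h1 h2 h3 h4 a b c d
  · linear_combination main e f _ _ _ _ he' hf' h2 h1 h4 h3 a b c d
  · linear_combination main e f _ _ _ _ he' hf' h3 h4 h1 h2 a b c d
  · linear_combination main e f _ _ _ _ he' hf' h4 h3 h2 h1 a b c d

end FLL

namespace FLL

section Comb

variable {V E : Type} [Fintype V] [DecidableEq V] [Fintype E]

theorem z2_add_self (x : ZMod 2) : x + x = 0 := CharTwo.add_self_eq_zero x

/-- incidence indicator -/
def inc (ends : E → Sym2 V) (v : V) (e : E) : ZMod 2 := if v ∈ ends e then 1 else 0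

theorem sum_ends {M : Type} [AddCommMonoid M] (ends : E → Sym2 V) {e : E} {u v : V}
    (he : ends e = s(u, v)) (huv : u ≠ v) (h : V → M) :
    ∑ r, (if r ∈ ends e then h r else 0) = h u + h v := by
  rw [← Finset.sum_filter]
  have : Finset.univ.filter (fun r => r ∈ ends e) = {u, v} := by
    ext r; simp [he]
  rw [this, Finset.sum_pair huv]

theorem sum_inc (ends : E → Sym2 V) {e : E} {u v : V} (he : ends e = s(u, v)) (huv : u ≠ v)
    (h : V → ZMod 2) : ∑ r, inc ends r e * h r = h u + h v := by
  rw [← sum_ends ends he huv h]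
  exact Finset.sum_congr rfl fun r _ => by simp [inc]

/-- The intersection form. -/
def XX (ends : E → Sym2 V) (B : E → V → ZMod 2) (g : V → V → ZMod 2) (e f : E) : ZMod 2 :=
  ∑ r, inc ends r f * B e r + ∑ p, inc ends p e * B f p +
    ∑ p, inc ends p e * ∑ r, inc ends r f * g p r

theorem exists_ends {ends : E → Sym2 V} (hloop : Loopless ends) (e : E) :
    ∃ u v, ends e = s(u, v) ∧ u ≠ v := by
  obtain ⟨⟨u, v⟩, huv⟩ := Quot.exists_rep (ends e)
  have huv' : ends e = s(u, v) := huv.symm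
  refine ⟨u, v, huv', fun h => hloop e ?_⟩
  rw [huv']; exact Sym2.mk_isDiag_iff.2 h

theorem XX_self {ends : E → Sym2 V} (hloop : Loopless ends) (B : E → V → ZMod 2)
    (g : V → V → ZMod 2) (hg0 : ∀ v, g v v = 0) (hg1 : ∀ u v, u ≠ v → g u v + g v u = 1) (e : E) :
    XX ends B g e e = 1 := by
  obtain ⟨u, v, he, huv⟩ := exists_ends hloop e
  unfold XX
  simp only [sum_inc ends he huv]
  rw [hg0, hg0]
  linear_combination hg1 u v huv + z2_add_self (B e u) + z2_add_self (B e v)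

theorem XX_swap {ends : E → Sym2 V} (hloop : Loopless ends) (B : E → V → ZMod 2)
    (g : V → V → ZMod 2) (hg0 : ∀ v, g v v = 0) (hg1 : ∀ u v, u ≠ v → g u v + g v u = 1)
    (e f : E) :
    XX ends B g f e = XX ends B g e f + ∑ v, inc ends v e * inc ends v f := by
  obtain ⟨u, v, he, huv⟩ := exists_ends hloop e
  obtain ⟨w, z, hf, hwz⟩ := exists_ends hloop f
  have hg : ∀ a b, g a b + g b a = 1 + if a = b then 1 else 0 := by
    intro a b
    split_ifs with h
    · subst h; rw [hg0]; decide
    · rw [hg1 a b h]; simp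
  unfold XX
  simp only [sum_inc ends he huv, sum_inc ends hf hwz]
  have i1 : ∀ a, inc ends a f = (if a = w then 1 else 0) + (if a = z then 1 else 0) := by
    intro a
    unfold inc
    rw [hf]
    by_cases h1 : a = w
    · simp [h1, hwz]
    · by_cases h2 : a = z <;> simp [h1, h2, hwz.symm]
  rw [i1, i1]
  have h4 : (1 + 1 + 1 + 1 : ZMod 2) = 0 := by decide
  linear_combination hg u w + hg u z + hg v w + hg v z + h4 - z2_add_self (g u w)
    - z2_add_self (g u z) - z2_add_self (g v w) - z2_add_self (g v z)

theorem XX_zero {ends : E → Sym2 V} (hloop : Loopless ends) (B : E → V → ZMod 2)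
    (g : V → V → ZMod 2)
    (hB : ∀ e f u v w z, ends e = s(u, v) → ends f = s(w, z) → u ≠ w → u ≠ z → v ≠ w → v ≠ z →
        B e w + B e z + B f u + B f v + g u w + g u z + g v w + g v z = 0)
    (e f : E) (h : ∀ v, v ∈ ends e → v ∉ ends f) : XX ends B g e f = 0 := by
  obtain ⟨u, v, he, huv⟩ := exists_ends hloop e
  obtain ⟨w, z, hf, hwz⟩ := exists_ends hloop f
  have hu := h u (by simp [he])
  have hv := h v (by simp [he])
  rw [hf] at hu hv
  simp only [Sym2.mem_iff, not_or] at hu hv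
  unfold XX
  simp only [sum_inc ends he huv, sum_inc ends hf hwz]
  linear_combination hB e f u v w z he hf hu.1 hu.2 hv.1 hv.2

theorem XX_cycles (ends : E → Sym2 V) (B : E → V → ZMod 2)
    (g : V → V → ZMod 2) (a b : E → ZMod 2) (ha : ∀ v, ∑ e, a e * inc ends v e = 0)
    (hb : ∀ v, ∑ e, b e * inc ends v e = 0) :
    ∑ e, ∑ f, a e * b f * XX ends B g e f = 0 := by
  have key : ∀ (b : E → ZMod 2), (∀ v, ∑ e, b e * inc ends v e = 0) → ∀ h : V → ZMod 2,
      ∑ f, b f * ∑ r, inc ends r f * h r = 0 := by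
    intro b hb h
    simp only [Finset.mul_sum]
    rw [Finset.sum_comm]
    refine Finset.sum_eq_zero fun r _ => ?_
    calc _ = (∑ f, b f * inc ends r f) * h r := by
          rw [Finset.sum_mul]; exact Finset.sum_congr rfl fun _ _ => by ring
      _ = 0 := by rw [hb, zero_mul]
  have e1 : ∑ e, ∑ f, a e * b f * ∑ r, inc ends r f * B e r = 0 := by
    refine Finset.sum_eq_zero fun e _ => ?_
    simp only [mul_assoc]
    rw [← Finset.mul_sum, key b hb, mul_zero]
  have e2 : ∑ e, ∑ f, a e * b f * ∑ p, inc ends p e * B f p = 0 := by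
    rw [Finset.sum_comm]
    refine Finset.sum_eq_zero fun f _ => ?_
    simp only [mul_comm (a _) (b f), mul_assoc]
    rw [← Finset.mul_sum, key a ha, mul_zero]
  have e3 : ∑ e, ∑ f, a e * b f * ∑ p, inc ends p e * ∑ r, inc ends r f * g p r = 0 := by
    rw [Finset.sum_comm]
    refine Finset.sum_eq_zero fun f _ => ?_
    simp only [mul_comm (a _) (b f), mul_assoc]
    rw [← Finset.mul_sum, key a ha, mul_zero]
  unfold XX
  simp only [mul_add, Finset.sum_add_distrib]
  rw [e1, e2, e3]; simp

variable [LinearOrder E]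

theorem sum_split {M : Type} [AddCommMonoid M] (h : E → E → M) :
    ∑ e, ∑ f, h e f = ∑ e, h e e + ∑ e, ∑ f, if e < f then h e f + h f e else 0 := by
  have h1 : ∀ e f, h e f = (if e = f then h e f else 0) + (if e < f then h e f else 0) +
      (if f < e then h e f else 0) := by
    intro e f
    rcases lt_trichotomy e f with h | h | h
    · simp [h, h.ne, h.not_gt]
    · simp [h]
    · simp [h, h.ne', h.not_gt]
  have h2 : ∀ e f, (if e < f then h e f + h f e else 0) =
      (if e < f then h e f else 0) + (if e < f then h f e else 0) := by
    intro e f; split_ifs <;> simp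
  simp only [h2]
  conv_lhs => enter [2, e, 2, f]; rw [h1]
  simp only [Finset.sum_add_distrib]
  rw [Finset.sum_comm (f := fun e f => if f < e then h e f else 0), add_assoc]
  congr 1
  exact Finset.sum_congr rfl fun e _ => by simp

/-- Inversion count mod 2 for an edge colouring. -/
theorem inv_col {ends : E → Sym2 V} (hloop : Loopless ends) (B : E → V → ZMod 2)
    (g : V → V → ZMod 2) (hg0 : ∀ v, g v v = 0) (hg1 : ∀ u v, u ≠ v → g u v + g v u = 1)
    (hB : ∀ e f u v w z, ends e = s(u, v) → ends f = s(w, z) → u ≠ w → u ≠ z → v ≠ w → v ≠ z →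
        B e w + B e z + B f u + B f v + g u w + g u z + g v w + g v z = 0)
    (l : E → ℕ) (hl2 : ∀ e, l e ≤ 2)
    (hl : ∀ v e f, v ∈ ends e → v ∈ ends f → e ≠ f → l e ≠ l f)
    (hl1 : ∀ v, ∀ k ≤ 2, ∑ e, (if v ∈ ends e then (if l e = k then 1 else 0) else 0) = 1) :
    (∑ e, ∑ f, if e < f then (if l f < l e then ∑ v, inc ends v e * inc ends v f else 0) else 0)
      = (∑ e, ∑ f, if e < f then XX ends B g e f else 0) + ∑ e, if l e = 1 then 1 else 0 := by
  have hl1' : ∀ v, ∀ k ≤ 2, ∑ e, (if l e = k then (1 : ZMod 2) else 0) * inc ends v e = 1 := by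
    intro v k hk
    have := congrArg (Nat.cast : ℕ → ZMod 2) (hl1 v k hk)
    push_cast at this
    refine Eq.trans (Finset.sum_congr rfl fun e _ => ?_) this
    unfold inc
    by_cases h1 : v ∈ ends e <;> simp [h1]
  have hc := XX_cycles ends B g (fun e => (if l e = 0 then 1 else 0) + (if l e = 1 then 1 else 0))
    (fun e => (if l e = 1 then 1 else 0) + (if l e = 2 then 1 else 0))
    (fun v => by
      simp only [add_mul, Finset.sum_add_distrib]
      rw [hl1' v 0 (by simp), hl1' v 1 (by simp)]; decide)
    (fun v => by
      simp only [add_mul, Finset.sum_add_distrib]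
      rw [hl1' v 2 (by simp), hl1' v 1 (by simp)]; decide)
  rw [sum_split] at hc
  have d : ∀ e, ((if l e = 0 then 1 else 0) + (if l e = 1 then 1 else 0)) *
      ((if l e = 1 then 1 else 0) + (if l e = 2 then 1 else 0)) * XX ends B g e e =
      if l e = 1 then 1 else 0 := by
    intro e
    rw [XX_self hloop B g hg0 hg1]
    by_cases h0 : l e = 0
    · simp [h0]
    · by_cases h1 : l e = 1 <;> simp [h0, h1]
  have o : ∀ e f, e < f →
      ((if l e = 0 then 1 else 0) + (if l e = 1 then 1 else 0)) *
      ((if l f = 1 then 1 else 0) + (if l f = 2 then 1 else 0)) * XX ends B g e f +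
      ((if l f = 0 then 1 else 0) + (if l f = 1 then 1 else 0)) *
      ((if l e = 1 then 1 else 0) + (if l e = 2 then 1 else 0)) * XX ends B g f e =
      XX ends B g e f + (if l f < l e then ∑ v, inc ends v e * inc ends v f else 0) := by
    intro e f hef
    have hs := XX_swap hloop B g hg0 hg1 e f
    have b1 := hl2 e
    have b2 := hl2 f
    by_cases hadj : ∃ v, v ∈ ends e ∧ v ∈ ends f
    · obtain ⟨v, hv1, hv2⟩ := hadj
      have hne := hl v e f hv1 hv2 hef.ne
      rw [hs]
      generalize l e = x at *
      generalize l f = y at *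
      interval_cases x <;> interval_cases y <;> simp at hne ⊢
    · push Not at hadj
      have z1 := XX_zero hloop B g hB e f hadj
      have z2 := XX_zero hloop B g hB f e (fun v h1 h2 => hadj v h2 h1)
      rw [z1, z2, zero_add] at hs
      rw [z1, z2, ← hs]; simp
  have hc2 : (∑ e, if l e = 1 then (1 : ZMod 2) else 0) + ((∑ e, ∑ f, if e < f then XX ends B g e f else 0) +
      ∑ e, ∑ f, if e < f then (if l f < l e then ∑ v, inc ends v e * inc ends v f else 0) else 0) = 0 := by
    refine Eq.trans ?_ hc
    rw [← Finset.sum_add_distrib (f := fun e => ∑ f, if e < f then XX ends B g e f else 0)]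
    refine congrArg₂ (· + ·) (Finset.sum_congr rfl fun e _ => (d e).symm)
      (Finset.sum_congr rfl fun e _ => ?_)
    rw [← Finset.sum_add_distrib]
    refine Finset.sum_congr rfl fun f _ => ?_
    by_cases h1 : e < f
    · simp only [if_pos h1]
      exact (o e f h1).symm
    · simp only [if_neg h1, add_zero]
  generalize (∑ e, if l e = 1 then (1 : ZMod 2) else 0) = x at *
  generalize (∑ e, ∑ f, if e < f then XX ends B g e f else 0) = y at *
  linear_combination hc2 - z2_add_self x - z2_add_self y

/-- Inversion count for a vertex-dependent labelling. -/
theorem inv_lab {ends : E → Sym2 V} (hloop : Loopless ends) (B : E → V → ZMod 2)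
    (g : V → V → ZMod 2) (hg0 : ∀ v, g v v = 0) (hg1 : ∀ u v, u ≠ v → g u v + g v u = 1)
    (hB : ∀ e f u v w z, ends e = s(u, v) → ends f = s(w, z) → u ≠ w → u ≠ z → v ≠ w → v ≠ z →
        B e w + B e z + B f u + B f v + g u w + g u z + g v w + g v z = 0)
    (hdeg : ∀ v, deg ends v = 3)
    (p : V → E → ℕ) (hp2 : ∀ v e, v ∈ ends e → p v e ≤ 2)
    (hp : ∀ v e f, v ∈ ends e → v ∈ ends f → e ≠ f → p v e ≠ p v f)
    (hp1 : ∀ v, ∀ k ≤ 2, ∃ e, v ∈ ends e ∧ p v e = k)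
    (hsum : ∀ e u v, ends e = s(u, v) → p u e + p v e = 2)
    (c : V → Bool) (hc : ∀ e u v, ends e = s(u, v) → p u e ≠ 1 → c u ≠ c v) :
    (∑ v, ∑ e, ∑ f, if v ∈ ends e ∧ v ∈ ends f ∧ e < f ∧ p v f < p v e then (1 : ZMod 2) else 0)
      = (∑ e, ∑ f, if e < f then XX ends B g e f else 0) := by
  have hq : ∀ e, ∃ k, ∀ v, v ∈ ends e → k = if c v then p v e else 2 - p v e := by
    intro e
    obtain ⟨u, w, he, huw⟩ := exists_ends hloop e
    refine ⟨if c u then p u e else 2 - p u e, ?_⟩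
    intro v hv
    rw [he, Sym2.mem_iff] at hv
    rcases hv with rfl | rfl
    · rfl
    · have h1 := hsum e u v he
      have h2 := hc e u v he
      by_cases h3 : p u e = 1
      · have : p v e = 1 := by omega
        simp [h3, this]
      · have := h2 h3
        cases hu : c u <;> cases hv : c v <;> simp [hu, hv] at this ⊢ <;> omega
  choose l hlv using hq
  have hl2 : ∀ e, l e ≤ 2 := by
    intro e
    obtain ⟨u, w, he, huw⟩ := exists_ends hloop e
    have hu : u ∈ ends e := by simp [he]
    have := hp2 u e hu
    rw [hlv e u hu]; split_ifs <;> omega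
  have hl : ∀ v e f, v ∈ ends e → v ∈ ends f → e ≠ f → l e ≠ l f := by
    intro v e f he hf hef
    have := hp v e f he hf hef
    have := hp2 v e he
    have := hp2 v f hf
    rw [hlv e v he, hlv f v hf]; split_ifs <;> omega
  have hl1 : ∀ v, ∀ k ≤ 2, ∑ e, (if v ∈ ends e then (if l e = k then 1 else 0) else 0) = 1 := by
    intro v k hk
    obtain ⟨e, he, hek⟩ : ∃ e, v ∈ ends e ∧ l e = k := by
      cases hcv : c v
      · obtain ⟨e, he, hek⟩ := hp1 v (2 - k) (by omega)
        exact ⟨e, he, by rw [hlv e v he]; simp [hcv]; omega⟩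
      · obtain ⟨e, he, hek⟩ := hp1 v k hk
        exact ⟨e, he, by rw [hlv e v he]; simp [hcv]; omega⟩
    rw [Finset.sum_eq_single e]
    · simp [he, hek]
    · intro f _ hfe
      split_ifs with h1 h2
      · exact absurd (hek.trans h2.symm) (hl v e f he h1 hfe.symm)
      · rfl
      · rfl
    · simp
  have main := inv_col hloop B g hg0 hg1 hB l hl2 hl hl1
  -- number of pairs
  have pairs : ∀ v, (∑ e, ∑ f, if v ∈ ends e ∧ v ∈ ends f ∧ e < f then (1 : ZMod 2) else 0) = 1 := by
    intro v
    have h3 : ∑ e, (if v ∈ ends e then 1 else 0) = 3 := by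
      rw [← hdeg v, deg, Finset.card_filter]
    have hs := sum_split (fun e f => (if v ∈ ends e then 1 else 0) * (if v ∈ ends f then 1 else 0))
    rw [← Finset.sum_mul_sum, h3] at hs
    have h4 : ∑ e, (if v ∈ ends e then 1 else 0) * (if v ∈ ends e then 1 else 0) = 3 := by
      rw [← h3]; refine Finset.sum_congr rfl fun e _ => ?_
      split_ifs <;> rfl
    have h5 : (∑ e, ∑ f, if e < f then
        (if v ∈ ends e then 1 else 0) * (if v ∈ ends f then 1 else 0) +
        (if v ∈ ends f then 1 else 0) * (if v ∈ ends e then 1 else 0) else 0) =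
        2 * ∑ e, ∑ f, if v ∈ ends e ∧ v ∈ ends f ∧ e < f then 1 else 0 := by
      rw [Finset.mul_sum]
      refine Finset.sum_congr rfl fun e _ => ?_
      rw [Finset.mul_sum]
      refine Finset.sum_congr rfl fun f _ => ?_
      by_cases a : v ∈ ends e <;> by_cases b : v ∈ ends f <;> by_cases d : e < f <;> simp [a, b, d]
    rw [h4, h5] at hs
    have h6 : (∑ e, ∑ f, if v ∈ ends e ∧ v ∈ ends f ∧ e < f then 1 else 0) = 3 := by omega
    have h7 := congrArg (Nat.cast : ℕ → ZMod 2) h6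
    push_cast at h7
    rw [h7]; decide
  -- counting
  have cnt : ∀ k ≤ 2, 2 * ∑ e, (if l e = k then 1 else 0) = Fintype.card V := by
    intro k hk
    calc 2 * ∑ e, (if l e = k then 1 else 0)
        = ∑ e, ∑ v, (if v ∈ ends e then (if l e = k then 1 else 0) else 0) := by
          rw [Finset.mul_sum]
          refine Finset.sum_congr rfl fun e _ => ?_
          obtain ⟨u, w, he, huw⟩ := exists_ends hloop e
          rw [sum_ends ends he huw]; ring
      _ = ∑ v, ∑ e, (if v ∈ ends e then (if l e = k then 1 else 0) else 0) := Finset.sum_comm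
      _ = ∑ v : V, 1 := Finset.sum_congr rfl fun v _ => hl1 v k hk
      _ = _ := by simp
  have cfalse : ∑ v, (if c v = false then 1 else 0) = ∑ e, (if l e = 0 then 1 else 0) := by
    calc ∑ v, (if c v = false then 1 else 0)
        = ∑ v, ∑ e, (if v ∈ ends e then
            (if l e = 0 then 1 else 0) * (if c v = false then 1 else 0) else 0) := by
          refine Finset.sum_congr rfl fun v _ => ?_
          refine (one_mul _).symm.trans ?_
          refine (congrArg (· * _) (hl1 v 0 (by simp)).symm).trans ?_
          refine (Finset.sum_mul _ _ _).trans ?_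
          exact Finset.sum_congr rfl fun e _ => by rw [ite_mul, zero_mul]
      _ = ∑ e, ∑ v, (if v ∈ ends e then
            (if l e = 0 then 1 else 0) * (if c v = false then 1 else 0) else 0) := Finset.sum_comm
      _ = _ := by
          refine Finset.sum_congr rfl fun e _ => ?_
          obtain ⟨u, w, he, huw⟩ := exists_ends hloop e
          rw [sum_ends ends he huw]
          by_cases h0 : l e = 0
          · have hu := hlv e u (by simp [he])
            have hpu : p u e ≠ 1 := by
              intro h; rw [h0, h] at hu; simp at hu
            have := hc e u w he hpu
            cases hu : c u <;> cases hw : c w <;> simp [hu, hw, h0] at this ⊢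
          · simp [h0]
  have cM : ∑ v, (if c v = false then (1 : ZMod 2) else 0) = ∑ e, if l e = 1 then 1 else 0 := by
    have h1 := cnt 0 (by simp)
    have h2 := cnt 1 (by simp)
    have : ∑ v, (if c v = false then 1 else 0) = ∑ e, (if l e = 1 then 1 else 0) := by omega
    have := congrArg (Nat.cast : ℕ → ZMod 2) this
    push_cast at this
    exact this
  -- assemble
  have pt : ∀ v e f, (if v ∈ ends e ∧ v ∈ ends f ∧ e < f ∧ p v f < p v e then (1 : ZMod 2) else 0) =
      (if e < f then (if l f < l e then inc ends v e * inc ends v f else 0) else 0) +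
      (if v ∈ ends e ∧ v ∈ ends f ∧ e < f then (1 : ZMod 2) else 0) *
        (if c v = false then 1 else 0) := by
    intro v e f
    by_cases a : v ∈ ends e
    · by_cases b : v ∈ ends f
      · by_cases d : e < f
        · have h1 := hp v e f a b d.ne
          have h2 := hp2 v e a
          have h3 := hp2 v f b
          simp only [a, b, d, true_and, inc, if_true, mul_one, one_mul]
          rw [hlv e v a, hlv f v b]
          cases hcv : c v
          · simp only [Bool.false_eq_true, if_false, if_true]
            by_cases h4 : p v f < p v e
            · rw [if_pos h4, if_neg (by omega)]; simp
            · rw [if_neg h4, if_pos (by omega)]; decide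
          · simp
        · simp [d]
      · simp [b, inc]
    · simp [a, inc]
  simp only [pt, Finset.sum_add_distrib, ← Finset.sum_mul, pairs, one_mul]
  rw [cM]
  have sw : (∑ v, ∑ e, ∑ f, if e < f then (if l f < l e then inc ends v e * inc ends v f else 0) else 0) =
    (∑ e, ∑ f, if e < f then (if l f < l e then ∑ v, inc ends v e * inc ends v f else 0) else 0) := by
    rw [Finset.sum_comm]
    refine Finset.sum_congr rfl fun e _ => ?_
    rw [Finset.sum_comm]
    refine Finset.sum_congr rfl fun f _ => ?_
    split_ifs <;> simp
  rw [sw, main, add_assoc, z2_add_self, add_zero]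

end Comb

section Final

variable {V E : Type} [Fintype V] [DecidableEq V] [Fintype E]

/-- labels as a total function -/
def lab (ends : E → Sym2 V) (π : Flag ends → ℕ) (v : V) (e : E) : ℕ :=
  if h : v ∈ ends e then π ⟨(v, e), h⟩ else 0

theorem lab_flag (ends : E → Sym2 V) (π : Flag ends → ℕ) (fl : Flag ends) :
    lab ends π fl.1.1 fl.1.2 = π fl := by
  unfold lab
  rw [dif_pos fl.2]
  rfl

/-- build a flag -/
def mkF (ends : E → Sym2 V) (v : V) (e : E) (h : v ∈ ends e) : Flag ends := ⟨(v, e), h⟩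

theorem flag_ext {ends : E → Sym2 V} {x y : Flag ends} (h1 : x.1.1 = y.1.1)
    (h2 : x.1.2 = y.1.2) : x = y := Subtype.ext (Prod.ext h1 h2)

theorem starSign_eq [LinearOrder E] (ends : E → Sym2 V) (π : Flag ends → ℕ)
    (hp : ∀ v e f, v ∈ ends e → v ∈ ends f → e ≠ f → lab ends π v e ≠ lab ends π v f) :
    ∃ N : ℕ, starSign ends π = (-1) ^ N ∧ (N : ZMod 2) =
      ∑ v, ∑ e, ∑ f, if v ∈ ends e ∧ v ∈ ends f ∧ e < f ∧ lab ends π v f < lab ends π v e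
        then (1 : ZMod 2) else 0 := by
  refine ⟨∑ p ∈ Finset.univ.filter
      (fun p : Flag ends × Flag ends => p.1.1.1 = p.2.1.1 ∧ p.1.1.2 < p.2.1.2),
      if π p.2 < π p.1 then 1 else 0, ?_, ?_⟩
  · rw [← Finset.prod_pow_eq_pow_sum]
    unfold starSign
    refine Finset.prod_congr rfl fun p hpm => ?_
    obtain ⟨h1, h2⟩ := (Finset.mem_filter.1 hpm).2
    have hne := hp p.1.1.1 p.1.1.2 p.2.1.2 p.1.2 (by rw [h1]; exact p.2.2) h2.ne
    rw [lab_flag, h1, lab_flag] at hne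
    split_ifs with h
    · rw [Int.sign_eq_neg_one_of_neg (by omega)]; rfl
    · rw [Int.sign_eq_one_of_pos (by omega)]; rfl
  · push_cast
    rw [← Finset.sum_filter, Finset.filter_filter]
    have : ∀ v, (∑ e, ∑ f, if v ∈ ends e ∧ v ∈ ends f ∧ e < f ∧ lab ends π v f < lab ends π v e
        then (1 : ZMod 2) else 0) = ∑ q : E × E, if v ∈ ends q.1 ∧ v ∈ ends q.2 ∧ q.1 < q.2 ∧
          lab ends π v q.2 < lab ends π v q.1 then (1 : ZMod 2) else 0 := fun v =>
      (Fintype.sum_prod_type (fun q : E × E => if v ∈ ends q.1 ∧ v ∈ ends q.2 ∧ q.1 < q.2 ∧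
          lab ends π v q.2 < lab ends π v q.1 then (1 : ZMod 2) else 0)).symm
    simp only [this]
    rw [← Fintype.sum_prod_type (fun q : V × E × E => if q.1 ∈ ends q.2.1 ∧ q.1 ∈ ends q.2.2 ∧
      q.2.1 < q.2.2 ∧ lab ends π q.1 q.2.2 < lab ends π q.1 q.2.1 then (1 : ZMod 2) else 0),
      ← Finset.sum_filter]
    refine Finset.sum_bij (fun p _ => (p.1.1.1, p.1.1.2, p.2.1.2)) ?_ ?_ ?_ ?_
    · rintro ⟨x, y⟩ hpm
      simp only [Finset.mem_filter, Finset.mem_univ, true_and] at hpm ⊢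
      obtain ⟨⟨h1, h2⟩, h3⟩ := hpm
      refine ⟨x.2, by rw [h1]; exact y.2, h2, ?_⟩
      rw [lab_flag, h1, lab_flag]; exact h3
    · rintro ⟨x, y⟩ hx ⟨x', y'⟩ hx' heq
      simp only [Finset.mem_filter, Finset.mem_univ, true_and] at hx hx'
      simp only [Prod.mk.injEq] at heq
      obtain ⟨a, b, d⟩ := heq
      refine Prod.ext (Subtype.ext (Prod.ext a b)) (Subtype.ext (Prod.ext ?_ d))
      exact hx.1.1.symm.trans (a.trans hx'.1.1)
    · rintro ⟨v, e, f⟩ hq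
      simp only [Finset.mem_filter, Finset.mem_univ, true_and] at hq
      obtain ⟨h1, h2, h3, h4⟩ := hq
      refine ⟨(⟨(v, e), h1⟩, ⟨(v, f), h2⟩), ?_, rfl⟩
      simp only [Finset.mem_filter, Finset.mem_univ, true_and]
      refine ⟨h3, ?_⟩
      simpa [lab, h1, h2] using h4
    · intros; rfl

theorem final_aux [DecidableEq E] [LinearOrder E] {ends : E → Sym2 V} (hloop : Loopless ends)
    (B : E → V → ZMod 2)
    (g : V → V → ZMod 2) (hg0 : ∀ v, g v v = 0) (hg1 : ∀ u v, u ≠ v → g u v + g v u = 1)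
    (hB : ∀ e f u v w z, ends e = s(u, v) → ends f = s(w, z) → u ≠ w → u ≠ z → v ≠ w → v ≠ z →
        B e w + B e z + B f u + B f v + g u w + g u z + g v w + g v z = 0)
    (hdeg : ∀ v, deg ends v = 3) (π : Flag ends → ℕ) (hπ : IsStarLabelling ends π)
    (hexp : ∀ e, exponent ends π e = 2)
    (hbip : ∃ c : V → Bool, ∀ e ∉ Mpi ends π, ∀ u v : V, ends e = s(u, v) → c u ≠ c v) :
    ∃ N : ℕ, starSign ends π = (-1) ^ N ∧ (N : ZMod 2) =
      (∑ e, ∑ f, if e < f then XX ends B g e f else 0) := by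
  obtain ⟨c, hc⟩ := hbip
  have labeq : ∀ v e (h : v ∈ ends e), lab ends π v e = π (mkF ends v e h) := fun v e h => by
    unfold lab; rw [dif_pos h]; rfl
  have hmem : ∀ v e, v ∈ ends e → lab ends π v e ∈ Finset.range 3 := by
    intro v e h
    rw [labeq v e h, ← hdeg v, ← hπ v]
    exact Finset.mem_image_of_mem _ (Finset.mem_filter.2 ⟨Finset.mem_univ _, rfl⟩)
  have hcard : (∀ v, (Finset.univ.filter (fun fl : Flag ends => fl.1.1 = v)).card = 3) := by
    intro v
    rw [← hdeg v, deg]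
    refine Finset.card_bij (fun fl _ => fl.1.2) ?_ ?_ ?_
    · intro fl hfl
      simp only [Finset.mem_filter, Finset.mem_univ, true_and] at hfl ⊢
      rw [← hfl]; exact fl.2
    · intro x hx y hy hxy
      simp only [Finset.mem_filter, Finset.mem_univ, true_and] at hx hy
      exact Subtype.ext (Prod.ext (hx.trans hy.symm) hxy)
    · intro e he
      simp only [Finset.mem_filter, Finset.mem_univ, true_and] at he
      exact ⟨mkF ends v e he, Finset.mem_filter.2 ⟨Finset.mem_univ _, rfl⟩, rfl⟩
  have hp : ∀ v e f, v ∈ ends e → v ∈ ends f → e ≠ f → lab ends π v e ≠ lab ends π v f := by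
    intro v e f he hf hef h
    have hinj : Set.InjOn π (Finset.univ.filter (fun fl : Flag ends => fl.1.1 = v)) := by
      rw [← Finset.card_image_iff, hπ v, hcard v, hdeg v, Finset.card_range]
    rw [labeq v e he, labeq v f hf] at h
    have := hinj (Finset.mem_coe.2 (Finset.mem_filter.2 ⟨Finset.mem_univ _, rfl⟩))
      (Finset.mem_coe.2 (Finset.mem_filter.2 ⟨Finset.mem_univ _, rfl⟩)) h
    exact hef (congrArg (fun x : Flag ends => x.1.2) this)
  obtain ⟨N, h1, h2⟩ := starSign_eq ends π hp
  refine ⟨N, h1, h2.trans ?_⟩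
  have hsum : ∀ e u v, ends e = s(u, v) → lab ends π u e + lab ends π v e = 2 := by
    intro e u v he
    have hu : u ∈ ends e := by simp [he]
    have hv : v ∈ ends e := by simp [he]
    have huv : u ≠ v := fun h => hloop e (by rw [he]; exact Sym2.mk_isDiag_iff.2 h)
    rw [← hexp e, exponent]
    have : Finset.univ.filter (fun fl : Flag ends => fl.1.2 = e) =
        {mkF ends u e hu, mkF ends v e hv} := by
      ext fl
      simp only [Finset.mem_filter, Finset.mem_univ, true_and, Finset.mem_insert,
        Finset.mem_singleton]
      constructor
      · intro h
        have h2 := fl.2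
        rw [h, he, Sym2.mem_iff] at h2
        rcases h2 with h2 | h2
        · exact Or.inl (flag_ext h2 h)
        · exact Or.inr (flag_ext h2 h)
      · rintro (h | h) <;> rw [h] <;> rfl
    rw [this, Finset.sum_pair, labeq u e hu, labeq v e hv]
    intro h
    exact huv (congrArg (fun x : Flag ends => x.1.1) h)
  refine inv_lab hloop B g hg0 hg1 hB hdeg (lab ends π) ?_ hp ?_ hsum c ?_
  · intro v e h
    have := Finset.mem_range.1 (hmem v e h)
    omega
  · intro v k hk
    have : k ∈ Finset.range (deg ends v) := by rw [hdeg v, Finset.mem_range]; omega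
    rw [← hπ v, Finset.mem_image] at this
    obtain ⟨fl, hfl, hk⟩ := this
    simp only [Finset.mem_filter, Finset.mem_univ, true_and] at hfl
    refine ⟨fl.1.2, by rw [← hfl]; exact fl.2, ?_⟩
    rw [← hfl, lab_flag, hk]
  · intro e u v he hne
    refine hc e (fun hM => hne ?_) u v he
    have hu : u ∈ ends e := by simp [he]
    rw [labeq u e hu]
    exact hM _ rfl

end Final

end FLL
open FLL

/-- Lemma 5.5, Ellingham–Goddyn.  Let `G` be a planar loopless cubic
graph with a fixed ordering of `E(G)`, and let `π, π′` be star labellings of `G` with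
exponent constantly `2` such that the complementary 2-factors `D_π` and `D_{π′}` are both
bipartite (admit a proper 2-colouring of the vertices, equivalently all their cycles are
even).  Then `sgn(π) = sgn(π′)`. -/
theorem statement13 (V E : Type) [Fintype V] [DecidableEq V] [Fintype E] [DecidableEq E]
    [LinearOrder E] (ends : E → Sym2 V)
    (hloop : Loopless ends) (hcubic : ∀ v, deg ends v = 3)
    (hplanar : Nonempty (PlanarEmbedding ends))
    (π π' : Flag ends → ℕ)
    (hπ : IsStarLabelling ends π) (hπ' : IsStarLabelling ends π')
    (hexp : ∀ e, exponent ends π e = 2) (hexp' : ∀ e, exponent ends π' e = 2)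
    (hbip : ∃ c : V → Bool, ∀ e ∉ Mpi ends π, ∀ u v : V, ends e = s(u, v) → c u ≠ c v)
    (hbip' : ∃ c : V → Bool, ∀ e ∉ Mpi ends π', ∀ u v : V, ends e = s(u, v) → c u ≠ c v) :
    starSign ends π = starSign ends π' := by
  obtain ⟨P⟩ := hplanar
  obtain ⟨B, g, hg0, hg1, hB⟩ := topo P
  obtain ⟨N, h1, h2⟩ := final_aux hloop B g hg0 hg1 hB hcubic π hπ hexp hbip
  obtain ⟨N', h1', h2'⟩ := final_aux hloop B g hg0 hg1 hB hcubic π' hπ' hexp' hbip'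
  rw [h1, h1']
  have h3 : (N : ZMod 2) = (N' : ZMod 2) := h2.trans h2'.symm
  rw [ZMod.natCast_eq_natCast_iff'] at h3
  rw [neg_one_pow_eq_pow_mod_two, h3, ← neg_one_pow_eq_pow_mod_two]
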